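/- arXiv:1708.07546 — 10 statements merged into one kernel-verified Lean document; each statement's English description precedes it below -/
import Mathlib

section
/- If λ is a real number with λ > √(243/155) (equivalently λ > 9√(3/155)), then the quadratic equation A₂(λ)k² + A₁(λ)k + A₀(λ) = 0 has exactly one positive real solution k. -/
/-- The coefficient `A₂(λ) = 7(λ−1)²(λ+3)(155λ²−243)`. -/
noncomputable def A2 (lam : ℝ) : ℝ := 7 * (lam - 1) ^ 2 * (lam + 3) * (155 * lam ^ 2 - 243)

/-- The coefficient `A₁(λ) = λ(λ−1)(2909λ³+8871λ²+2547λ+20169)`. -/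
noncomputable def A1 (lam : ℝ) : ℝ :=
  lam * (lam - 1) * (2909 * lam ^ 3 + 8871 * lam ^ 2 + 2547 * lam + 20169)

/-- The coefficient `A₀(λ) = −4λ³(967λ²+8580λ+20637)`. -/
noncomputable def A0 (lam : ℝ) : ℝ := -4 * lam ^ 3 * (967 * lam ^ 2 + 8580 * lam + 20637)

/-- A real quadratic with positive leading coefficient and negative constant term has exactly one
positive root. -/
theorem existsUnique_pos_root_of_pos_of_neg {a b c : ℝ} (ha : 0 < a) (hc : c < 0) :
    ∃! k : ℝ, 0 < k ∧ a * k ^ 2 + b * k + c = 0 := by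
  have hac : a * c < 0 := mul_neg_of_pos_of_neg ha hc
  obtain ⟨s, hs, hb⟩ : ∃ s : ℝ, s ^ 2 = b ^ 2 - 4 * a * c ∧ b < s :=
    ⟨Real.sqrt (b ^ 2 - 4 * a * c), Real.sq_sqrt (by nlinarith [sq_nonneg b]),
      Real.lt_sqrt_of_sq_lt (by linarith)⟩
  obtain ⟨x, hx, hx0⟩ : ∃ x : ℝ, 0 < x ∧ a * x ^ 2 + b * x + c = 0 := by
    refine ⟨(-b + s) / (2 * a), div_pos (by linarith) (by linarith), ?_⟩
    field_simp
    linear_combination hs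
  refine ⟨x, ⟨hx, hx0⟩, ?_⟩
  rintro y ⟨hy, hy0⟩
  have h : (y - x) * (a * x * y - c) = 0 := by linear_combination x * hy0 - y * hx0
  have hpos : 0 < a * x * y := by positivity
  exact sub_eq_zero.mp ((mul_eq_zero.mp h).resolve_right (by linarith))

/-- for `λ > √(243/155)` the quadratic `A₂(λ)k² + A₁(λ)k + A₀(λ) = 0`
has exactly one positive real root `k`. -/
theorem stmt_4 (lam : ℝ) (hlam : lam > Real.sqrt (243 / 155)) :
    ∃! k : ℝ, 0 < k ∧ A2 lam * k ^ 2 + A1 lam * k + A0 lam = 0 := by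
  have h0 : 0 ≤ Real.sqrt (243 / 155) := Real.sqrt_nonneg _
  have hsq : 243 / 155 < lam ^ 2 := Real.lt_sq_of_sqrt_lt hlam
  have hpos : 0 < lam := lt_of_le_of_lt h0 hlam
  have h1 : 0 < lam - 1 := by nlinarith
  have h2 : 0 < 155 * lam ^ 2 - 243 := by linarith
  refine existsUnique_pos_root_of_pos_of_neg ?_ ?_
  · unfold A2
    positivity
  · have : 0 < 4 * lam ^ 3 * (967 * lam ^ 2 + 8580 * lam + 20637) := by positivity
    unfold A0
    linarith
end

section
/- Let λ be a real number with λ < −3 or λ > 1, and set k = 4(λ+6)² / (7(λ−1)(λ+3)) (which is a positive real number). Then A₂(λ)k² + A₁(λ)k + A₀(λ) = 0 if and only if λ = 9/2 or λ = −16/5. -/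
/-- for `λ < −3` or `λ > 1` and `k = 4(λ+6)²/(7(λ−1)(λ+3))`,
the quadratic `A₂(λ)k² + A₁(λ)k + A₀(λ)` vanishes iff `λ = 9/2` or `λ = −16/5`. -/
theorem stmt_6 (lam k : ℝ) (hlam : lam < -3 ∨ lam > 1)
    (hk : k = 4 * (lam + 6) ^ 2 / (7 * (lam - 1) * (lam + 3))) :
    A2 lam * k ^ 2 + A1 lam * k + A0 lam = 0 ↔ lam = 9 / 2 ∨ lam = -16 / 5 := by
  have h1 : lam - 1 ≠ 0 := by
    rcases hlam with h | h
    · exact ne_of_lt (by linarith)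
    · exact ne_of_gt (by linarith)
  have h3 : lam + 3 ≠ 0 := by
    rcases hlam with h | h
    · exact ne_of_lt (by linarith)
    · exact ne_of_gt (by linarith)
  have key : A2 lam * k ^ 2 + A1 lam * k + A0 lam =
      -(1296 / 7) * (lam + 3) ^ 2 * (lam - 1) * ((2 * lam - 9) * (5 * lam + 16)) := by
    subst hk
    unfold A2 A1 A0
    field_simp
    ring
  have hc : -(1296 / 7) * (lam + 3) ^ 2 * (lam - 1) ≠ 0 :=
    mul_ne_zero (mul_ne_zero (by norm_num) (pow_ne_zero 2 h3)) h1
  rw [key, mul_eq_zero_iff_left hc, mul_eq_zero]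
  constructor
  · rintro (h | h)
    · left; linarith
    · right; linarith
  · rintro (h | h)
    · left; linarith
    · right; linarith
end

section
/- Let λ, a20, b02 be real numbers with −9 < λ < −9/5, a20 ≠ 0, and b02² = −108(λ+6)²a20² / (7(λ+9)(5λ+9)) (the right-hand side is positive for such λ). Then f̃₁(a20, b02, λ) = 0 if and only if λ = −16/5. -/
/-- for `−9 < λ < −9/5`, `a20 ≠ 0` and
`b02² = −108(λ+6)²a20²/(7(λ+9)(5λ+9))`, the polynomial `f̃₁` vanishes iff `λ = −16/5`. -/
theorem stmt_7 (lam a20 b02 : ℝ) (h1 : -9 < lam) (h2 : lam < -9 / 5) (ha : a20 ≠ 0)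
    (hb : b02 ^ 2 = -108 * (lam + 6) ^ 2 * a20 ^ 2 / (7 * (lam + 9) * (5 * lam + 9))) :
    (43092 * a20 ^ 4 + 52305 * a20 ^ 2 * b02 ^ 2 + 8675 * b02 ^ 4) * lam ^ 6
      + (386532 * a20 ^ 4 + 597639 * a20 ^ 2 * b02 ^ 2 + 86980 * b02 ^ 4) * lam ^ 5
      + 9 * (45900 * a20 ^ 4 + 56538 * a20 ^ 2 * b02 ^ 2 - 8377 * b02 ^ 4) * lam ^ 4
      - 162 * (5202 * a20 ^ 4 + 68961 * a20 ^ 2 * b02 ^ 2 + 11720 * b02 ^ 4) * lam ^ 3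
      - 729 * b02 ^ 2 * (47283 * a20 ^ 2 + 6887 * b02 ^ 2) * lam ^ 2
      - 177147 * b02 ^ 2 * (159 * a20 ^ 2 + 28 * b02 ^ 2) * lam
      - 1594323 * b02 ^ 4 = 0
    ↔ lam = -16 / 5 := by
  have h9 : lam + 9 ≠ 0 := (by linarith : 0 < lam + 9).ne'
  have h59 : 5 * lam + 9 ≠ 0 := (by linarith : 5 * lam + 9 < 0).ne
  have hl1 : lam - 1 ≠ 0 := (by linarith : lam - 1 < 0).ne
  have hl2 : 2 * lam - 9 ≠ 0 := (by linarith : 2 * lam - 9 < 0).ne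
  have hD : 7 * (lam + 9) * (5 * lam + 9) ≠ 0 := by simp [h9, h59]
  rw [eq_div_iff hD] at hb
  have key : ∀ x : ℝ, x = -34992 / 49 * a20 ^ 4 * (lam + 9) ^ 2 * (5 * lam + 9)
      * (lam - 1) * (2 * lam - 9) * (5 * lam + 16) → (x = 0 ↔ lam = -16 / 5) := by
    rintro x rfl
    constructor
    · intro h
      have h16 : 5 * lam + 16 = 0 := by simpa [ha, h9, h59, hl1, hl2] using h
      linarith
    · rintro rfl
      norm_num
  apply key
  apply mul_right_cancel₀ (pow_ne_zero 2 hD)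
  linear_combination
    ((-177147 * 159 * lam - 729 * 47283 * lam ^ 2 - 162 * 68961 * lam ^ 3 + 9 * 56538 * lam ^ 4
          + 597639 * lam ^ 5 + 52305 * lam ^ 6) * a20 ^ 2 * (7 * (lam + 9) * (5 * lam + 9))
      + (-1594323 - 177147 * 28 * lam - 729 * 6887 * lam ^ 2 - 162 * 11720 * lam ^ 3
          - 9 * 8377 * lam ^ 4 + 86980 * lam ^ 5 + 8675 * lam ^ 6)
        * (b02 ^ 2 * (7 * (lam + 9) * (5 * lam + 9)) + -108 * (lam + 6) ^ 2 * a20 ^ 2)) * hb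
end

section
/- Let k and λ be real numbers such that A₂(λ)k² + A₁(λ)k + A₀(λ) = 0 and 4(λ−1)²k² + (λ−1)(25λ−81)k + 196λ² = 0. Then λ(λ+1)(λ−1)(397378λ⁴ + 3696797λ³ + 12760835λ² + 19311435λ + 10762227) = 0. -/
/-- if `k` is a common root of `A₂(λ)k² + A₁(λ)k + A₀(λ)` and
`4(λ−1)²k² + (λ−1)(25λ−81)k + 196λ²`, then the resultant polynomial
`λ(λ+1)(λ−1)(397378λ⁴+3696797λ³+12760835λ²+19311435λ+10762227)` vanishes. -/
theorem stmt_9 (k lam : ℝ)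
    (h1 : A2 lam * k ^ 2 + A1 lam * k + A0 lam = 0)
    (h2 : 4 * (lam - 1) ^ 2 * k ^ 2 + (lam - 1) * (25 * lam - 81) * k + 196 * lam ^ 2 = 0) :
    lam * (lam + 1) * (lam - 1) *
      (397378 * lam ^ 4 + 3696797 * lam ^ 3 + 12760835 * lam ^ 2
        + 19311435 * lam + 10762227) = 0 := by
  rcases eq_or_ne lam 0 with rfl | hlam
  · ring
  rcases eq_or_ne lam 1 with rfl | hlam'
  · ring
  have hlam_sub : lam - 1 ≠ 0 := sub_ne_zero.mpr hlam'
  have hk : k ≠ 0 := by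
    rintro rfl
    exact hlam (by simpa using h2)
  unfold A2 A1 A0 at h1
  have hlin : (15489 * lam ^ 4 - 41994 * lam ^ 3 - 316368 * lam ^ 2 - 70470 * lam + 413343)
      * ((lam - 1) * k)
      + (228132 * lam ^ 5 + 775260 * lam ^ 4 - 3204 * lam ^ 3 - 1000188 * lam ^ 2) = 0 := by
    linear_combination 7 * (lam + 3) * (155 * lam ^ 2 - 243) * h2 - 4 * h1
  have hlin' : (228132 * lam ^ 5 + 775260 * lam ^ 4 - 3204 * lam ^ 3 - 1000188 * lam ^ 2)
      * ((lam - 1) * k)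
      + (666864 * lam ^ 6 + 2283408 * lam ^ 5 - 217008 * lam ^ 4 - 2733264 * lam ^ 3) = 0 := by
    refine (mul_eq_zero.mp ?_).resolve_left (mul_ne_zero hlam_sub hk)
    linear_combination 196 * lam ^ 2 * h1
      + 4 * lam ^ 3 * (967 * lam ^ 2 + 8580 * lam + 20637) * h2
  refine (mul_eq_zero.mp ?_).resolve_left
    (mul_ne_zero (mul_ne_zero (by norm_num : (104976 : ℝ) ≠ 0) (pow_ne_zero 2 hlam)) hlam_sub)
  linear_combination
    (228132 * lam ^ 5 + 775260 * lam ^ 4 - 3204 * lam ^ 3 - 1000188 * lam ^ 2) * hlin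
    - (15489 * lam ^ 4 - 41994 * lam ^ 3 - 316368 * lam ^ 2 - 70470 * lam + 413343) * hlin'
end

section
/- Let a20, b02, λ be real numbers with a20 ≠ 0, b02 ≠ 0 and λ ≠ 1, and set b20 = −(b02/4)(λ+3), a11 = (b02/4)(λ−5), a02 = (a20²λ − b02²(λ−1))/(6a20), b11 = −(a20²(λ² + 21λ + 6) − b02²(λ−1)(λ+3))/(6a20(λ−1)). Then L₁ = L₂ = L₃ = L₄ = 0 (note that under these substitutions 7b20 + b02(λ+6) = (3/4)(1−λ)b02 ≠ 0, so L₄ is well defined). -/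
open Real

/-- under the substitutions of Case (A1)(a), namely
`b20 = −(b02/4)(λ+3)`, `a11 = (b02/4)(λ−5)`, `a02 = (a20²λ − b02²(λ−1))/(6a20)`,
`b11 = −(a20²(λ²+21λ+6) − b02²(λ−1)(λ+3))/(6a20(λ−1))`, the first four Lyapunov
constants `L₁, L₂, L₃, L₄` all vanish. -/
theorem stmt_10 (a20 b02 lam a11 a02 b20 b11 : ℝ)
    (ha : a20 ≠ 0) (hb : b02 ≠ 0) (hl : lam ≠ 1)
    (hb20 : b20 = -(b02 / 4) * (lam + 3))
    (ha11 : a11 = (b02 / 4) * (lam - 5))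
    (ha02 : a02 = (a20 ^ 2 * lam - b02 ^ 2 * (lam - 1)) / (6 * a20))
    (hb11 : b11 = -(a20 ^ 2 * (lam ^ 2 + 21 * lam + 6)
        - b02 ^ 2 * (lam - 1) * (lam + 3)) / (6 * a20 * (lam - 1))) :
    -(2 / 3) * (a11 + 2 * b02 + b20) * lam = 0
    ∧ -(π / 8) * (b20 * (a20 + a02) + (2 * a20 + b11) * (b20 + b02)) * lam = 0
    ∧ -(2 / 105) * lam *
        ((6 * a20 * b02 * (2 * a20 + b11) + b20 * (3 * a20 ^ 2 + 4 * b02 ^ 2)) * (lam + 6)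
          + 14 * b20 * (3 * a20 * (2 * a20 + b11) + 2 * b20 * b02)) = 0
    ∧ (a20 * b20 * lam * π) / (1536 * (7 * b20 + b02 * (lam + 6)) ^ 2)
        * (4 * b20 + b02 * (lam + 3)) * (12 * b20 + b02 * (lam + 9))
        * (3 * a20 ^ 2 * (lam + 6) ^ 2 - 28 * b20 * (7 * b20 + b02 * (lam + 6))) = 0 := by
  have hl' : lam - 1 ≠ 0 := sub_ne_zero.mpr hl
  subst hb20 ha11 ha02 hb11
  refine ⟨by ring, ?_, ?_, ?_⟩
  · field_simp
    ring
  · field_simp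
    ring
  · have h : 4 * (-(b02 / 4) * (lam + 3)) + b02 * (lam + 3) = 0 := by ring
    rw [h]
    ring
end

section
/- Let a20, b02, λ be real numbers with a20 ≠ 0, b02 ≠ 0 and λ ≠ −9/5, and set b20 = −(b02/12)(λ+9), a11 = (b02/12)(λ−15), a02 = −(9a20²λ(λ+13) + b02²(λ−3)(5λ+9))/(18a20(5λ+9)), b11 = (a20²(9λ² − 45λ + 162) + b02²(λ+9)(5λ+9))/(18a20(5λ+9)). Then L₁ = L₂ = L₃ = L₄ = 0 (note that under these substitutions 7b20 + b02(λ+6) = (b02/12)(5λ+9) ≠ 0, so L₄ is well defined). -/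
open Real

/-- under the substitutions of Case (A1)(b), namely
`b20 = −(b02/12)(λ+9)`, `a11 = (b02/12)(λ−15)`,
`a02 = −(9a20²λ(λ+13) + b02²(λ−3)(5λ+9))/(18a20(5λ+9))`,
`b11 = (a20²(9λ²−45λ+162) + b02²(λ+9)(5λ+9))/(18a20(5λ+9))`, the first four
Lyapunov constants `L₁, L₂, L₃, L₄` all vanish. -/
theorem stmt_11 (a20 b02 lam a11 a02 b20 b11 : ℝ)
    (ha : a20 ≠ 0) (hb : b02 ≠ 0) (hl : lam ≠ -9 / 5)
    (hb20 : b20 = -(b02 / 12) * (lam + 9))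
    (ha11 : a11 = (b02 / 12) * (lam - 15))
    (ha02 : a02 = -(9 * a20 ^ 2 * lam * (lam + 13)
        + b02 ^ 2 * (lam - 3) * (5 * lam + 9)) / (18 * a20 * (5 * lam + 9)))
    (hb11 : b11 = (a20 ^ 2 * (9 * lam ^ 2 - 45 * lam + 162)
        + b02 ^ 2 * (lam + 9) * (5 * lam + 9)) / (18 * a20 * (5 * lam + 9))) :
    -(2 / 3) * (a11 + 2 * b02 + b20) * lam = 0
    ∧ -(π / 8) * (b20 * (a20 + a02) + (2 * a20 + b11) * (b20 + b02)) * lam = 0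
    ∧ -(2 / 105) * lam *
        ((6 * a20 * b02 * (2 * a20 + b11) + b20 * (3 * a20 ^ 2 + 4 * b02 ^ 2)) * (lam + 6)
          + 14 * b20 * (3 * a20 * (2 * a20 + b11) + 2 * b20 * b02)) = 0
    ∧ (a20 * b20 * lam * π) / (1536 * (7 * b20 + b02 * (lam + 6)) ^ 2)
        * (4 * b20 + b02 * (lam + 3)) * (12 * b20 + b02 * (lam + 9))
        * (3 * a20 ^ 2 * (lam + 6) ^ 2 - 28 * b20 * (7 * b20 + b02 * (lam + 6))) = 0 := by
  have hD : 5 * lam + 9 ≠ 0 := fun h => hl (by linarith)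
  obtain ⟨D, hlam⟩ : ∃ D : ℝ, lam = (D - 9) / 5 := ⟨5 * lam + 9, by ring⟩
  have hlD : 5 * lam + 9 = D := by rw [hlam]; ring
  rw [hlD] at hD ha02 hb11
  subst hb20 ha11 ha02 hb11 hlam
  refine ⟨by ring, ?_, ?_, ?_⟩
  · field_simp
    ring
  · field_simp
    ring
  · have h : 12 * (-(b02 / 12) * ((D - 9) / 5 + 9)) + b02 * ((D - 9) / 5 + 9) = 0 := by ring
    rw [h, mul_zero, zero_mul]
end

section
/- For all real x, y with (x, y) ≠ (0, 0), the function H₁ is differentiable at (x, y) and F(x, y)·∂H₁/∂x(x, y) + G(x, y)·∂H₁/∂y(x, y) = 0; that is, H₁ is a first integral of the planar system ẋ = F, ẏ = G away from the origin. -/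
/-- The vector field component `F(x,y) = −y + (a20x² − 2b02xy + a02y²)(x²+y²)^((λ−1)/2)`. -/
noncomputable def Fvec (a20 b02 a02 lam x y : ℝ) : ℝ :=
  -y + (a20 * x ^ 2 - 2 * b02 * x * y + a02 * y ^ 2) * (x ^ 2 + y ^ 2) ^ ((lam - 1) / 2)

/-- The vector field component `G(x,y) = x − (2a20x − b02y)y(x²+y²)^((λ−1)/2)`. -/
noncomputable def Gvec (a20 b02 a02 lam x y : ℝ) : ℝ :=
  x - (2 * a20 * x - b02 * y) * y * (x ^ 2 + y ^ 2) ^ ((lam - 1) / 2)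

/-- `H₁(x,y) = 6λ(x²+y²)^((3−λ)/2) + 2λ(λ−3)y[3(a20x − b02y)x + a02y²]`. -/
noncomputable def H1 (a20 b02 a02 lam : ℝ) (p : ℝ × ℝ) : ℝ :=
  6 * lam * (p.1 ^ 2 + p.2 ^ 2) ^ ((3 - lam) / 2)
    + 2 * lam * (lam - 3) * p.2 * (3 * (a20 * p.1 - b02 * p.2) * p.1 + a02 * p.2 ^ 2)

/-- The Fréchet derivative of `H₁` at a point other than the origin. -/
theorem hasFDerivAt_H1 (a20 b02 a02 lam x y : ℝ) (hr : x ^ 2 + y ^ 2 ≠ 0) :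
    HasFDerivAt (H1 a20 b02 a02 lam)
      ((6 * lam * (3 - lam)
          * (x * (x ^ 2 + y ^ 2) ^ ((1 - lam) / 2) - (2 * a20 * x - b02 * y) * y))
            • ContinuousLinearMap.fst ℝ ℝ ℝ
        + (6 * lam * (3 - lam) * (y * (x ^ 2 + y ^ 2) ^ ((1 - lam) / 2)
            - (a20 * x ^ 2 - 2 * b02 * x * y + a02 * y ^ 2)))
            • ContinuousLinearMap.snd ℝ ℝ ℝ) (x, y) := by
  have h₁ : HasFDerivAt (fun p : ℝ × ℝ => p.1) (ContinuousLinearMap.fst ℝ ℝ ℝ) (x, y) :=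
    hasFDerivAt_fst
  have h₂ : HasFDerivAt (fun p : ℝ × ℝ => p.2) (ContinuousLinearMap.snd ℝ ℝ ℝ) (x, y) :=
    hasFDerivAt_snd
  have hpow := ((h₁.pow 2).add (h₂.pow 2)).rpow_const (p := (3 - lam) / 2) (Or.inl hr)
  have hcubic := (h₂.const_mul (2 * lam * (lam - 3))).mul
    (((((h₁.const_mul a20).sub (h₂.const_mul b02)).const_mul 3).mul h₁).add
      ((h₂.pow 2).const_mul a02))
  have hexp : (3 - lam) / 2 - 1 = (1 - lam) / 2 := by ring
  refine ((hpow.const_mul (6 * lam)).add hcubic).congr_fderiv ?_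
  ext <;> simp [hexp] <;> ring

/-- away from the origin, `H₁` is differentiable and is a first
integral of the system `ẋ = F`, `ẏ = G`:
`F·∂H₁/∂x + G·∂H₁/∂y = 0` at every `(x,y) ≠ (0,0)`. -/
theorem stmt_12 (a20 b02 a02 lam : ℝ) (x y : ℝ) (h : (x, y) ≠ (0, 0)) :
    DifferentiableAt ℝ (H1 a20 b02 a02 lam) (x, y)
    ∧ Fvec a20 b02 a02 lam x y * fderiv ℝ (H1 a20 b02 a02 lam) (x, y) (1, 0)
      + Gvec a20 b02 a02 lam x y * fderiv ℝ (H1 a20 b02 a02 lam) (x, y) (0, 1) = 0 := by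
  have hr : 0 < x ^ 2 + y ^ 2 := by
    refine lt_of_le_of_ne (by positivity) fun h0 => h ?_
    have hx : x = 0 := by nlinarith [sq_nonneg x, sq_nonneg y]
    have hy : y = 0 := by nlinarith [sq_nonneg x, sq_nonneg y]
    rw [hx, hy]
  have hH := hasFDerivAt_H1 a20 b02 a02 lam x y hr.ne'
  refine ⟨hH.differentiableAt, ?_⟩
  have hmul : (x ^ 2 + y ^ 2) ^ ((lam - 1) / 2) * (x ^ 2 + y ^ 2) ^ ((1 - lam) / 2) = 1 := by
    rw [← Real.rpow_add hr, show (lam - 1) / 2 + (1 - lam) / 2 = 0 by ring, Real.rpow_zero]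
  rw [hH.fderiv, Fvec, Gvec]
  simp only [add_apply, smul_apply, ContinuousLinearMap.coe_fst',
    ContinuousLinearMap.coe_snd', smul_eq_mul, mul_one, mul_zero, add_zero, zero_add]
  generalize (x ^ 2 + y ^ 2) ^ ((lam - 1) / 2) = R at *
  generalize (x ^ 2 + y ^ 2) ^ ((1 - lam) / 2) = S at *
  linear_combination 6 * lam * (3 - lam) * (x * (a20 * x ^ 2 - 2 * b02 * x * y + a02 * y ^ 2)
    - y * ((2 * a20 * x - b02 * y) * y)) * hmul
end

section
/- Let b20, b11 be real numbers with b20 ≠ 0, set γ = √(b11² + 8b20²) (so γ > |b11|) and α = 4b20²/(γ(γ + b11)). Define H₃(x, y) = (b20x − 1)·(b20x + 1 + ((b11 + γ)/2)y)^α·(b20x + 1 + ((b11 − γ)/2)y)^(1−α) on the open set U = {(x, y) : b20x + 1 + ((b11 + γ)/2)y > 0 and b20x + 1 + ((b11 − γ)/2)y > 0}. Then for every (x, y) ∈ U, H₃ is differentiable at (x, y) and F(x, y)·∂H₃/∂x(x, y) + G(x, y)·∂H₃/∂y(x, y) = 0, where F(x, y) = −y + b20xy and G(x, y) = x + b20x²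 + b11xy − b20y²; that is, H₃ is a first integral of ẋ = F, ẏ = G on U. -/
/-- `γ = √(b11² + 8b20²)`. -/
noncomputable def gam (b20 b11 : ℝ) : ℝ := Real.sqrt (b11 ^ 2 + 8 * b20 ^ 2)

/-- `α = 4b20²/(γ(γ + b11))`. -/
noncomputable def alph (b20 b11 : ℝ) : ℝ :=
  4 * b20 ^ 2 / (gam b20 b11 * (gam b20 b11 + b11))

/-- `H₃(x,y) = (b20x − 1)(b20x + 1 + ((b11+γ)/2)y)^α (b20x + 1 + ((b11−γ)/2)y)^(1−α)`. -/
noncomputable def H3 (b20 b11 : ℝ) (p : ℝ × ℝ) : ℝ :=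
  (b20 * p.1 - 1)
    * (b20 * p.1 + 1 + ((b11 + gam b20 b11) / 2) * p.2) ^ alph b20 b11
    * (b20 * p.1 + 1 + ((b11 - gam b20 b11) / 2) * p.2) ^ (1 - alph b20 b11)

theorem gam_sq (b20 b11 : ℝ) : gam b20 b11 ^ 2 = b11 ^ 2 + 8 * b20 ^ 2 :=
  Real.sq_sqrt (by positivity)

theorem abs_lt_gam {b20 : ℝ} (hb20 : b20 ≠ 0) (b11 : ℝ) : |b11| < gam b20 b11 := by
  rw [← Real.sqrt_sq_eq_abs]
  exact Real.sqrt_lt_sqrt (sq_nonneg _) (by linarith [sq_pos_of_ne_zero hb20])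

/-- The weights `α` and `1 - α` balance the slopes `(b11 ± γ)/2`. -/
theorem alph_mul_gam {b20 : ℝ} (hb20 : b20 ≠ 0) (b11 : ℝ) :
    alph b20 b11 * gam b20 b11 = (gam b20 b11 - b11) / 2 := by
  have hlt := abs_lt_gam hb20 b11
  have hγ : gam b20 b11 ≠ 0 := (lt_of_le_of_lt (abs_nonneg _) hlt).ne'
  have hsum : gam b20 b11 + b11 ≠ 0 := by
    have := (abs_lt.mp hlt).1
    linarith
  unfold alph
  field_simp
  linear_combination -gam_sq b20 b11

theorem hasFDerivAt_affine (b c d : ℝ) (p : ℝ × ℝ) :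
    HasFDerivAt (fun q : ℝ × ℝ => b * q.1 + c + d * q.2)
      (b • ContinuousLinearMap.fst ℝ ℝ ℝ + d • ContinuousLinearMap.snd ℝ ℝ ℝ) p :=
  ((hasFDerivAt_fst.const_mul b).add_const c).add (hasFDerivAt_snd.const_mul d)

/-- on the open set where both lines
`b20x + 1 + ((b11±γ)/2)y` are positive, `H₃` is differentiable and is a first
integral of `ẋ = −y + b20xy`, `ẏ = x + b20x² + b11xy − b20y²`. -/
theorem stmt_15 (b20 b11 : ℝ) (hb20 : b20 ≠ 0) (x y : ℝ)
    (h1 : 0 < b20 * x + 1 + ((b11 + gam b20 b11) / 2) * y)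
    (h2 : 0 < b20 * x + 1 + ((b11 - gam b20 b11) / 2) * y) :
    DifferentiableAt ℝ (H3 b20 b11) (x, y)
    ∧ (-y + b20 * x * y) * fderiv ℝ (H3 b20 b11) (x, y) (1, 0)
      + (x + b20 * x ^ 2 + b11 * x * y - b20 * y ^ 2)
          * fderiv ℝ (H3 b20 b11) (x, y) (0, 1) = 0 := by
  have hL := (hasFDerivAt_affine b20 1 ((b11 + gam b20 b11) / 2) (x, y)).rpow_const
    (p := alph b20 b11) (Or.inl h1.ne')
  have hM := (hasFDerivAt_affine b20 1 ((b11 - gam b20 b11) / 2) (x, y)).rpow_const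
    (p := 1 - alph b20 b11) (Or.inl h2.ne')
  have hK := ((hasFDerivAt_fst (𝕜 := ℝ) (p := (x, y))).const_mul b20).sub_const 1
  have hH : HasFDerivAt (H3 b20 b11) _ (x, y) := (hK.mul hL).mul hM
  refine ⟨hH.differentiableAt, ?_⟩
  rw [hH.fderiv]
  have hγ := gam_sq b20 b11
  have hα := alph_mul_gam hb20 b11
  simp only [Pi.mul_apply, add_apply, smul_apply, smul_eq_mul, ContinuousLinearMap.coe_fst',
    ContinuousLinearMap.coe_snd', Real.rpow_sub_one h1.ne', Real.rpow_sub_one h2.ne']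
  clear hH hK hL hM
  generalize gam b20 b11 = γ at *
  generalize alph b20 b11 = α at *
  set L := b20 * x + 1 + (b11 + γ) / 2 * y with hLdef
  set M := b20 * x + 1 + (b11 - γ) / 2 * y with hMdef
  have eL : b20 * (-y + b20 * x * y)
      + (b11 + γ) / 2 * (x + b20 * x ^ 2 + b11 * x * y - b20 * y ^ 2)
      = L * ((b11 + γ) / 2 * x - b20 * y) := by
    rw [hLdef]; linear_combination (-x * y / 4) * hγ
  have eM : b20 * (-y + b20 * x * y)
      + (b11 - γ) / 2 * (x + b20 * x ^ 2 + b11 * x * y - b20 * y ^ 2)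
      = M * ((b11 - γ) / 2 * x - b20 * y) := by
    rw [hMdef]; linear_combination (-x * y / 4) * hγ
  have hL0 := h1.ne'
  have hM0 := h2.ne'
  clear_value L M
  generalize L ^ α = A at *
  generalize M ^ (1 - α) = B at *
  have cL : L * L⁻¹ = 1 := mul_inv_cancel₀ hL0
  have cM : M * M⁻¹ = 1 := mul_inv_cancel₀ hM0
  simp only [div_eq_mul_inv] at *
  linear_combination (b20 * x - 1) * A * B * (α * L⁻¹ * eL + (1 - α) * M⁻¹ * eM
    + α * ((b11 + γ) / 2 * x - b20 * y) * cL
    + (1 - α) * ((b11 - γ) / 2 * x - b20 * y) * cM + x * hα)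
end

section
/- Let a20, b20 be real numbers with b20 ≠ 0, and set a11 = (2b20² − 3a20²)/(2b20), b11 = −(5/2)a20, a02 = a20(3a20² − 8b20²)/(8b20²), b02 = (3a20² − 4b20²)/(4b20). Define F(x, y) = −y + a20x² + a11xy + a02y², G(x, y) = x + b20x² + b11xy + b02y², and H₄(x, y) = (2b20x − a20y − 2)²·[4(b20x + 1)² − 4a20(1 + 3b20x)y + (3a20² − 8b20²)y²]. Then the polynomial identity F·∂H₄/∂x + G·∂H₄/∂y = 0 holds for all real x, y; that is, H₄ is a first integral of the quadratic system ẋ = F, ẏ = G. -/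
/-- `H₄(x,y) = (2b20x − a20y − 2)²[4(b20x+1)² − 4a20(1+3b20x)y + (3a20²−8b20²)y²]`. -/
def H4 (a20 b20 x y : ℝ) : ℝ :=
  (2 * b20 * x - a20 * y - 2) ^ 2 *
    (4 * (b20 * x + 1) ^ 2 - 4 * a20 * (1 + 3 * b20 * x) * y
      + (3 * a20 ^ 2 - 8 * b20 ^ 2) * y ^ 2)

/-- The partial derivative of `H4` in its first variable. -/
theorem hasDerivAt_H4_fst (a b x y : ℝ) :
    HasDerivAt (fun t => H4 a b t y)
      ((2 * b * x - a * y - 2) *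
        (4 * b * (4 * (b * x + 1) ^ 2 - 4 * a * (1 + 3 * b * x) * y
            + (3 * a ^ 2 - 8 * b ^ 2) * y ^ 2)
          + (2 * b * x - a * y - 2) * (8 * b * (b * x + 1) - 12 * a * b * y))) x := by
  have hid := hasDerivAt_id' x
  have hL := ((hid.const_mul (2 * b)).sub_const (a * y)).sub_const 2
  have hQ := (((((hid.const_mul b).add_const 1).fun_pow 2).const_mul 4).fun_sub
    ((((hid.const_mul (3 * b)).const_add 1).const_mul (4 * a)).mul_const y)).add_const
      ((3 * a ^ 2 - 8 * b ^ 2) * y ^ 2)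
  refine ((hL.fun_pow 2).fun_mul hQ).congr_deriv ?_
  norm_num
  ring

/-- The partial derivative of `H4` in its second variable. -/
theorem hasDerivAt_H4_snd (a b x y : ℝ) :
    HasDerivAt (fun t => H4 a b x t)
      ((2 * b * x - a * y - 2) *
        (-2 * a * (4 * (b * x + 1) ^ 2 - 4 * a * (1 + 3 * b * x) * y
            + (3 * a ^ 2 - 8 * b ^ 2) * y ^ 2)
          + (2 * b * x - a * y - 2)
            * (-4 * a * (1 + 3 * b * x) + 2 * (3 * a ^ 2 - 8 * b ^ 2) * y))) y := by
  have hid := hasDerivAt_id' y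
  have hL := ((hid.const_mul a).const_sub (2 * b * x)).sub_const 2
  have hQ := ((hid.const_mul (4 * a * (1 + 3 * b * x))).const_sub
    (4 * (b * x + 1) ^ 2)).fun_add ((hid.fun_pow 2).const_mul (3 * a ^ 2 - 8 * b ^ 2))
  refine ((hL.fun_pow 2).fun_mul hQ).congr_deriv ?_
  norm_num
  ring


/-- with `a11 = (2b20² − 3a20²)/(2b20)`, `b11 = −(5/2)a20`,
`a02 = a20(3a20² − 8b20²)/(8b20²)`, `b02 = (3a20² − 4b20²)/(4b20)`, the polynomial
`H₄` is a first integral of the quadratic system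
`ẋ = −y + a20x² + a11xy + a02y²`, `ẏ = x + b20x² + b11xy + b02y²`:
`F·∂H₄/∂x + G·∂H₄/∂y = 0` identically. -/
theorem stmt_16 (a20 b20 : ℝ) (hb20 : b20 ≠ 0)
    (a11 b11 a02 b02 : ℝ)
    (ha11 : a11 = (2 * b20 ^ 2 - 3 * a20 ^ 2) / (2 * b20))
    (hb11 : b11 = -(5 / 2) * a20)
    (ha02 : a02 = a20 * (3 * a20 ^ 2 - 8 * b20 ^ 2) / (8 * b20 ^ 2))
    (hb02 : b02 = (3 * a20 ^ 2 - 4 * b20 ^ 2) / (4 * b20)) :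
    ∀ x y : ℝ,
      (-y + a20 * x ^ 2 + a11 * x * y + a02 * y ^ 2)
          * deriv (fun t => H4 a20 b20 t y) x
        + (x + b20 * x ^ 2 + b11 * x * y + b02 * y ^ 2)
          * deriv (fun t => H4 a20 b20 x t) y = 0 := by
  intro x y
  have hx := (hasDerivAt_H4_fst a20 b20 x y).deriv
  have hy := (hasDerivAt_H4_snd a20 b20 x y).deriv
  rw [hx, hy, ha11, hb11, ha02, hb02]
  field_simp
  ring
end

section
/- Let a02 be a real number and define the planar vector fields V(x, y) = (−y − a02(4x² − y²), x − 2a02xy) and W(x, y) = (x − 4a02xy(1 − a02y), y − a02y²(3 − 2a02y)). Then the Lie bracket [V, W] = DW·V − DV·W vanishes identically on ℝ²; i.e., for all real x, y, ∂W/∂x·V₁ + ∂W/∂y·V₂ − ∂V/∂x·W₁ − ∂V/∂y·W₂ = 0 in both components. -/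
/-- First component of `V(x,y) = (−y − a02(4x² − y²), x − 2a02xy)`. -/
def V1 (a02 x y : ℝ) : ℝ := -y - a02 * (4 * x ^ 2 - y ^ 2)

/-- Second component of `V`. -/
def V2 (a02 x y : ℝ) : ℝ := x - 2 * a02 * x * y

/-- First component of `W(x,y) = (x − 4a02xy(1 − a02y), y − a02y²(3 − 2a02y))`. -/
def W1 (a02 x y : ℝ) : ℝ := x - 4 * a02 * x * y * (1 - a02 * y)

/-- Second component of `W`. -/
def W2 (a02 x y : ℝ) : ℝ := y - a02 * y ^ 2 * (3 - 2 * a02 * y)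

theorem hasDerivAt_V1_fst (a x y : ℝ) : HasDerivAt (fun t => V1 a t y) (-8 * a * x) x := by
  refine HasDerivAt.congr_deriv
    (((((hasDerivAt_pow 2 x).const_mul 4).sub_const (y ^ 2)).const_mul a).const_sub (-y)) ?_
  norm_num
  ring

theorem hasDerivAt_V1_snd (a x y : ℝ) : HasDerivAt (fun t => V1 a x t) (-1 + 2 * a * y) y := by
  refine HasDerivAt.congr_deriv
    ((hasDerivAt_id' y).neg.sub (((hasDerivAt_pow 2 y).const_sub (4 * x ^ 2)).const_mul a)) ?_
  norm_num
  ring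

theorem hasDerivAt_V2_fst (a x y : ℝ) : HasDerivAt (fun t => V2 a t y) (1 - 2 * a * y) x := by
  refine HasDerivAt.congr_deriv
    ((hasDerivAt_id' x).sub (((hasDerivAt_id' x).const_mul (2 * a)).mul_const y)) ?_
  ring

theorem hasDerivAt_V2_snd (a x y : ℝ) : HasDerivAt (fun t => V2 a x t) (-2 * a * x) y := by
  refine HasDerivAt.congr_deriv (((hasDerivAt_id' y).const_mul (2 * a * x)).const_sub x) ?_
  ring

theorem hasDerivAt_W1_fst (a x y : ℝ) :
    HasDerivAt (fun t => W1 a t y) (1 - 4 * a * y * (1 - a * y)) x := by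
  refine HasDerivAt.congr_deriv ((hasDerivAt_id' x).sub
    ((((hasDerivAt_id' x).const_mul (4 * a)).mul_const y).mul_const (1 - a * y))) ?_
  ring

theorem hasDerivAt_W1_snd (a x y : ℝ) :
    HasDerivAt (fun t => W1 a x t) (-4 * a * x * (1 - 2 * a * y)) y := by
  refine HasDerivAt.congr_deriv ((((hasDerivAt_id' y).const_mul (4 * a * x)).mul
    (((hasDerivAt_id' y).const_mul a).const_sub 1)).const_sub x) ?_
  ring

theorem hasDerivAt_W2_fst (a x y : ℝ) : HasDerivAt (fun t => W2 a t y) 0 x :=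
  hasDerivAt_const x _

theorem hasDerivAt_W2_snd (a x y : ℝ) :
    HasDerivAt (fun t => W2 a x t) (1 - 6 * a * y + 6 * a ^ 2 * y ^ 2) y := by
  refine HasDerivAt.congr_deriv ((hasDerivAt_id' y).sub (((hasDerivAt_pow 2 y).const_mul a).mul
    (((hasDerivAt_id' y).const_mul (2 * a)).const_sub 3))) ?_
  norm_num
  ring

/-- the Lie bracket `[V, W] = DW·V − DV·W` vanishes identically
on `ℝ²`, in both components. -/
theorem stmt_17 (a02 : ℝ) (x y : ℝ) :
    (deriv (fun t => W1 a02 t y) x * V1 a02 x y + deriv (fun t => W1 a02 x t) y * V2 a02 x y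
      - deriv (fun t => V1 a02 t y) x * W1 a02 x y
      - deriv (fun t => V1 a02 x t) y * W2 a02 x y = 0)
    ∧ (deriv (fun t => W2 a02 t y) x * V1 a02 x y + deriv (fun t => W2 a02 x t) y * V2 a02 x y
      - deriv (fun t => V2 a02 t y) x * W1 a02 x y
      - deriv (fun t => V2 a02 x t) y * W2 a02 x y = 0) := by
  rw [(hasDerivAt_V1_fst a02 x y).deriv, (hasDerivAt_V1_snd a02 x y).deriv,
    (hasDerivAt_V2_fst a02 x y).deriv, (hasDerivAt_V2_snd a02 x y).deriv,
    (hasDerivAt_W1_fst a02 x y).deriv, (hasDerivAt_W1_snd a02 x y).deriv,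
    (hasDerivAt_W2_fst a02 x y).deriv, (hasDerivAt_W2_snd a02 x y).deriv]
  unfold V1 V2 W1 W2
  constructor <;> ring
end
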